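/- Let ρ̊ : [0,R₀] → (0,∞) be continuous and radial, and ξ(X) = F(|X|) X/|X| a smooth radial vector field on B(R₀) ⊂ ℝ³. Then the vector field W_i(X) = ∂_i ∂_j ∫_{B(R₀)} ρ̊(|X'|) ξ^j(X') / |X - X'| dX' equals -4π ρ̊(|X|) ξ_i(X), because both sides have the same divergence and any spherically symmetric divergence-free vector field regular at the origin vanishes. -/

import Mathlib

open MeasureTheory

lemma polar_aux1 (f : ℝ × ℝ → ENNReal) (hf : Measurable f) (a : ℝ) :
    ∫⁻ p : ℝ × ℝ, f (Real.sqrt (a ^ 2 + (p.1 ^ 2 + p.2 ^ 2)), a)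
      = ENNReal.ofReal (2 * Real.pi) *
        ∫⁻ q in Set.Ioi (0:ℝ), ENNReal.ofReal q * f (Real.sqrt (a ^ 2 + q ^ 2), a) := by
  have h1 := lintegral_comp_polarCoord_symm
    (fun p : ℝ × ℝ => f (Real.sqrt (a ^ 2 + (p.1 ^ 2 + p.2 ^ 2)), a))
  rw [← h1, polarCoord_target]
  have h2 : ∀ p : ℝ × ℝ, ENNReal.ofReal p.1 • f (Real.sqrt (a ^ 2 + ((polarCoord.symm p).1 ^ 2
      + (polarCoord.symm p).2 ^ 2)), a)
      = ENNReal.ofReal p.1 * f (Real.sqrt (a ^ 2 + p.1 ^ 2), a) := by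
    intro p
    rw [polarCoord_symm_apply, smul_eq_mul]
    have : (p.1 * Real.cos p.2) ^ 2 + (p.1 * Real.sin p.2) ^ 2 = p.1 ^ 2 := by
      have := Real.sin_sq_add_cos_sq p.2
      linear_combination p.1 ^ 2 * this
    simp only [this]
  simp only [h2]
  rw [Measure.volume_eq_prod, ← Measure.prod_restrict, lintegral_prod _ (by fun_prop)]
  simp only [lintegral_const, Measure.restrict_apply_univ, Real.volume_Ioo]
  rw [lintegral_mul_const _ (by fun_prop), mul_comm]
  congr 2; ring

lemma polar_aux2 (f : ℝ × ℝ → ENNReal) (hf : Measurable f) :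
    ∫⁻ a : ℝ, ∫⁻ q in Set.Ioi (0:ℝ), ENNReal.ofReal q * f (Real.sqrt (a ^ 2 + q ^ 2), a)
      = ∫⁻ p in Set.Ioi (0:ℝ) ×ˢ Set.Ioo 0 Real.pi,
          ENNReal.ofReal (p.1 ^ 2 * Real.sin p.2) * f (p.1, p.1 * Real.cos p.2) := by
  have h0 : ∀ a : ℝ, ∫⁻ q in Set.Ioi (0:ℝ), ENNReal.ofReal q * f (Real.sqrt (a ^ 2 + q ^ 2), a)
      = ∫⁻ q, ENNReal.ofReal q * f (Real.sqrt (a ^ 2 + q ^ 2), a) := by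
    intro a
    rw [← lintegral_indicator measurableSet_Ioi]
    congr 1; ext q
    by_cases hq : 0 < q
    · simp [hq]
    · simp [hq, ENNReal.ofReal_of_nonpos (not_lt.1 hq)]
  simp only [h0]
  have h1 := lintegral_comp_polarCoord_symm
    (fun p : ℝ × ℝ => ENNReal.ofReal p.2 * f (Real.sqrt (p.1 ^ 2 + p.2 ^ 2), p.1))
  rw [← lintegral_prod (f := fun p : ℝ × ℝ => ENNReal.ofReal p.2 *
    f (Real.sqrt (p.1 ^ 2 + p.2 ^ 2), p.1)) (by fun_prop), ← Measure.volume_eq_prod,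
    ← h1, polarCoord_target]
  rw [← lintegral_indicator (measurableSet_Ioi.prod measurableSet_Ioo),
    ← lintegral_indicator (measurableSet_Ioi.prod measurableSet_Ioo)]
  congr 1; ext p
  obtain ⟨s, t⟩ := p
  simp only [Set.indicator_apply, Set.mem_prod, Set.mem_Ioi, Set.mem_Ioo, polarCoord_symm_apply]
  by_cases hs : 0 < s
  · have : (s * Real.cos t) ^ 2 + (s * Real.sin t) ^ 2 = s ^ 2 := by
      have := Real.sin_sq_add_cos_sq t
      linear_combination s ^ 2 * this
    rw [this, Real.sqrt_sq hs.le]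
    by_cases ht : 0 < t ∧ t < Real.pi
    · rw [if_pos ⟨hs, by linarith [ht.1, Real.pi_pos], ht.2⟩, if_pos ⟨hs, ht⟩, smul_eq_mul,
        ← mul_assoc, ← ENNReal.ofReal_mul hs.le]
      congr 2; ring
    · rw [if_neg (by tauto : ¬ (0 < s ∧ 0 < t ∧ t < Real.pi))]
      split_ifs with h
      · have : s * Real.sin t ≤ 0 := by
          apply mul_nonpos_of_nonneg_of_nonpos hs.le
          apply Real.sin_nonpos_of_nonpos_of_neg_pi_le
          · by_contra h'
            exact ht ⟨not_le.1 h', h.2.2⟩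
          · exact h.2.1.le
        rw [ENNReal.ofReal_of_nonpos this]; simp
      · rfl
  · simp [hs]

lemma polar3 (f : ℝ × ℝ → ENNReal) (hf : Measurable f) :
    ∫⁻ x : EuclideanSpace ℝ (Fin 3), f (‖x‖, x 0)
      = ENNReal.ofReal (2 * Real.pi) * ∫⁻ p in Set.Ioi (0:ℝ) ×ˢ Set.Ioo 0 Real.pi,
          ENNReal.ofReal (p.1 ^ 2 * Real.sin p.2) * f (p.1, p.1 * Real.cos p.2) := by
  rw [← polar_aux2 f hf, ← lintegral_const_mul _ (by
    apply Measurable.lintegral_prod_right'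
      (f := fun p : ℝ × ℝ => ENNReal.ofReal p.2 * f (Real.sqrt (p.1 ^ 2 + p.2 ^ 2), p.1))
    fun_prop)]
  simp only [← polar_aux1 f hf]
  have e1 := (EuclideanSpace.volume_preserving_symm_measurableEquiv_toLp (Fin 3)).lintegral_comp
    (f := fun y : Fin 3 → ℝ => f (Real.sqrt (y 0 ^ 2 + (y 1 ^ 2 + y 2 ^ 2)), y 0)) (by fun_prop)
  have e2 := (volume_preserving_piFinSuccAbove (fun _ : Fin 3 => ℝ) 0).lintegral_comp
    (f := fun y : ℝ × (Fin 2 → ℝ) => f (Real.sqrt (y.1 ^ 2 + (y.2 0 ^ 2 + y.2 1 ^ 2)), y.1))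
    (by fun_prop)
  have e3 := fun a : ℝ => (volume_preserving_finTwoArrow ℝ).lintegral_comp
    (f := fun y : ℝ × ℝ => f (Real.sqrt (a ^ 2 + (y.1 ^ 2 + y.2 ^ 2)), a))
    (by fun_prop)
  have e4 : ∫⁻ x : EuclideanSpace ℝ (Fin 3), f (‖x‖, x 0) = 
     ∫⁻ y : Fin 3 → ℝ, f (Real.sqrt (y 0 ^ 2 + (y 1 ^ 2 + y 2 ^ 2)), y 0) := by
    rw [← e1]
    congr 1; ext x
    simp only [EuclideanSpace.norm_eq, Fin.sum_univ_three, Real.norm_eq_abs, sq_abs]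
    simp [add_assoc]
  rw [e4]
  have e5 : ∫⁻ y : Fin 3 → ℝ, f (Real.sqrt (y 0 ^ 2 + (y 1 ^ 2 + y 2 ^ 2)), y 0) =
     ∫⁻ y : ℝ × (Fin 2 → ℝ), f (Real.sqrt (y.1 ^ 2 + (y.2 0 ^ 2 + y.2 1 ^ 2)), y.1) := by
    rw [← e2]; rfl
  rw [e5, Measure.volume_eq_prod, lintegral_prod _ (by fun_prop)]
  congr 1; ext a
  rw [← e3]; rfl

/-- the polar measure -/
noncomputable def nuM : Measure (ℝ × ℝ) :=
  (volume.restrict (Set.Ioi (0:ℝ) ×ˢ Set.Ioo 0 Real.pi)).withDensity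
    (fun p => ENNReal.ofReal (2 * Real.pi * (p.1 ^ 2 * Real.sin p.2)))

lemma map_nuM (u : EuclideanSpace ℝ (Fin 3)) (hu : ‖u‖ = 1) :
    Measure.map (fun x : EuclideanSpace ℝ (Fin 3) => (‖x‖, inner ℝ u x)) volume
      = Measure.map (fun p : ℝ × ℝ => (p.1, p.1 * Real.cos p.2)) nuM := by
  have ⟨b, hb⟩ := Orthonormal.exists_orthonormalBasis_extension_of_card_eq (𝕜 := ℝ)
    (E := EuclideanSpace ℝ (Fin 3)) (ι := Fin 3) (by simp) (v := fun _ => u) (s := {0}) (by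
      rw [orthonormal_iff_ite]
      rintro ⟨i, hi⟩ ⟨j, hj⟩
      have hi : i = 0 := hi
      have hj : j = 0 := hj
      subst hi hj
      simp [Set.domRestrict, hu])
  have hb0 : b 0 = u := hb 0 rfl
  have hm := b.repr.measurePreserving
  have hcomp : (fun x : EuclideanSpace ℝ (Fin 3) => (‖x‖, inner ℝ u x)) =
      (fun x : EuclideanSpace ℝ (Fin 3) => (‖x‖, x 0)) ∘ b.repr := by
    ext x
    · simp
    · simp [OrthonormalBasis.repr_apply_apply, hb0]
  rw [hcomp, ← Measure.map_map (by fun_prop) hm.measurable, hm.map_eq]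
  apply Measure.ext_of_lintegral
  intro f hf
  rw [lintegral_map hf (by fun_prop), lintegral_map hf (by fun_prop), polar3 f hf, nuM,
    lintegral_withDensity_eq_lintegral_mul _ (by fun_prop) (by fun_prop),
    ← lintegral_const_mul _ (by fun_prop)]
  congr 1; ext p
  simp only [Pi.mul_apply]
  rw [← mul_assoc, ← ENNReal.ofReal_mul (by positivity)]

lemma integrable_polar (u : EuclideanSpace ℝ (Fin 3)) (hu : ‖u‖ = 1) (G : ℝ × ℝ → ℝ)
    (hG : Measurable G) :
    Integrable (fun x => G (‖x‖, inner ℝ u x)) volume ↔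
    Integrable (fun p : ℝ × ℝ => 2 * Real.pi * (p.1 ^ 2 * Real.sin p.2) * G (p.1, p.1 * Real.cos p.2))
      (volume.restrict (Set.Ioi (0:ℝ) ×ˢ Set.Ioo 0 Real.pi)) := by
  have h1 := integrable_map_measure (μ := volume)
    (f := (fun x : EuclideanSpace ℝ (Fin 3) => (‖x‖, inner ℝ u x))) (g := G)
    hG.aestronglyMeasurable (by fun_prop)
  have h2 := integrable_map_measure (μ := nuM)
    (f := (fun p : ℝ × ℝ => (p.1, p.1 * Real.cos p.2))) (g := G)
    hG.aestronglyMeasurable (by fun_prop)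
  rw [map_nuM u hu] at h1
  refine h1.symm.trans (h2.trans ?_)
  rw [nuM, integrable_withDensity_iff_integrable_smul' (by fun_prop) (by simp)]
  apply integrable_congr
  filter_upwards [ae_restrict_mem (measurableSet_Ioi.prod measurableSet_Ioo)] with p hp
  have : 0 ≤ Real.sin p.2 := Real.sin_nonneg_of_nonneg_of_le_pi hp.2.1.le hp.2.2.le
  simp only [Function.comp, smul_eq_mul]
  rw [ENNReal.toReal_ofReal (by positivity)]

lemma integral_polar (u : EuclideanSpace ℝ (Fin 3)) (hu : ‖u‖ = 1) (G : ℝ × ℝ → ℝ)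
    (hG : Measurable G) :
    ∫ x, G (‖x‖, inner ℝ u x) =
    ∫ p in (Set.Ioi (0:ℝ) ×ˢ Set.Ioo 0 Real.pi), 
      2 * Real.pi * (p.1 ^ 2 * Real.sin p.2) * G (p.1, p.1 * Real.cos p.2) := by
  have h1 := integral_map (μ := volume)
    (φ := (fun x : EuclideanSpace ℝ (Fin 3) => (‖x‖, inner ℝ u x))) (f := G)
    (by fun_prop) hG.aestronglyMeasurable
  have h2 := integral_map (μ := nuM)
    (φ := (fun p : ℝ × ℝ => (p.1, p.1 * Real.cos p.2))) (f := G)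
    (by fun_prop) hG.aestronglyMeasurable 
  rw [← h1, map_nuM u hu, h2, nuM, integral_withDensity_eq_integral_toReal_smul (by fun_prop) (by simp)]
  apply integral_congr_ae
  filter_upwards [ae_restrict_mem (measurableSet_Ioi.prod measurableSet_Ioo)] with p hp
  have : 0 ≤ Real.sin p.2 := Real.sin_nonneg_of_nonneg_of_le_pi hp.2.1.le hp.2.2.le
  simp only [smul_eq_mul]
  rw [ENNReal.toReal_ofReal (by positivity)]

lemma ang_pos (r s t : ℝ) (hrs : s ≠ r) (hr : 0 < r) (hs : 0 < s) :
    0 < r ^ 2 + s ^ 2 - 2 * r * (s * Real.cos t) := by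
  have h1 := Real.cos_le_one t
  have h2 : 0 < (s - r) ^ 2 := by
    have := sub_ne_zero.2 hrs
    positivity
  nlinarith [mul_pos hr hs]

lemma ang_deriv (r s t : ℝ) (hrs : s ≠ r) (hr : 0 < r) (hs : 0 < s) :
    HasDerivAt (fun t => Real.sqrt (r ^ 2 + s ^ 2 - 2 * r * (s * Real.cos t)))
      (r * s * Real.sin t / Real.sqrt (r ^ 2 + s ^ 2 - 2 * r * (s * Real.cos t))) t := by
  have h := ang_pos r s t hrs hr hs
  have h1 : HasDerivAt (fun t => r ^ 2 + s ^ 2 - 2 * r * (s * Real.cos t))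
      (2 * r * s * Real.sin t) t := by
    have := (((Real.hasDerivAt_cos t).const_mul s).const_mul (2 * r)).const_sub (r ^ 2 + s ^ 2)
    exact this.congr_deriv (by ring)
  refine (h1.sqrt h.ne').congr_deriv ?_
  field_simp

lemma ang_cont (r s : ℝ) (hrs : s ≠ r) (hr : 0 < r) (hs : 0 < s) :
    Continuous (fun t => Real.sin t / Real.sqrt (r ^ 2 + s ^ 2 - 2 * r * (s * Real.cos t))) := by
  apply Continuous.div (by fun_prop) (by fun_prop)
  intro t
  exact (Real.sqrt_pos.2 (ang_pos r s t hrs hr hs)).ne'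

lemma ang_int0 (r s : ℝ) (hrs : s ≠ r) (hr : 0 < r) (hs : 0 < s) :
    ∫ t in Set.Ioo 0 Real.pi, Real.sin t / Real.sqrt (r ^ 2 + s ^ 2 - 2 * r * (s * Real.cos t))
      = (r + s - |r - s|) / (r * s) := by
  rw [← integral_Ioc_eq_integral_Ioo, ← intervalIntegral.integral_of_le Real.pi_pos.le]
  rw [intervalIntegral.integral_eq_sub_of_hasDerivAt (f := fun t =>
    Real.sqrt (r ^ 2 + s ^ 2 - 2 * r * (s * Real.cos t)) / (r * s))]
  · simp only [Real.cos_pi, Real.cos_zero]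
    rw [show r ^ 2 + s ^ 2 - 2 * r * (s * -1) = (r + s) ^ 2 by ring,
      show r ^ 2 + s ^ 2 - 2 * r * (s * 1) = (r - s) ^ 2 by ring, Real.sqrt_sq (by positivity),
      Real.sqrt_sq_eq_abs]
    ring
  · intro t _
    refine ((ang_deriv r s t hrs hr hs).div_const (r * s)).congr_deriv ?_
    field_simp
  · exact (ang_cont r s hrs hr hs).intervalIntegrable _ _

lemma ang_int1 (r s : ℝ) (hrs : s ≠ r) (hr : 0 < r) (hs : 0 < s) :
    ∫ t in Set.Ioo 0 Real.pi, Real.cos t *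
      (Real.sin t / Real.sqrt (r ^ 2 + s ^ 2 - 2 * r * (s * Real.cos t)))
      = if s < r then 2 * s / (3 * r ^ 2) else 2 * r / (3 * s ^ 2) := by
  rw [← integral_Ioc_eq_integral_Ioo, ← intervalIntegral.integral_of_le Real.pi_pos.le]
  rw [intervalIntegral.integral_eq_sub_of_hasDerivAt (f := fun t =>
    ((r ^ 2 + s ^ 2) * Real.sqrt (r ^ 2 + s ^ 2 - 2 * r * (s * Real.cos t)) - 
     Real.sqrt (r ^ 2 + s ^ 2 - 2 * r * (s * Real.cos t)) ^ 3 / 3) / (2 * r ^ 2 * s ^ 2))]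
  · simp only [Real.cos_pi, Real.cos_zero]
    rw [show r ^ 2 + s ^ 2 - 2 * r * (s * -1) = (r + s) ^ 2 by ring,
      show r ^ 2 + s ^ 2 - 2 * r * (s * 1) = (r - s) ^ 2 by ring, Real.sqrt_sq (by positivity),
      Real.sqrt_sq_eq_abs]
    split_ifs with h
    · rw [abs_of_pos (by linarith)]
      field_simp
      ring
    · rw [abs_of_nonpos (by linarith)]
      field_simp
      ring
  · intro t _
    have hd := ang_deriv r s t hrs hr hs
    have hp := ang_pos r s t hrs hr hs
    refine (((hd.const_mul (r ^ 2 + s ^ 2)).sub ((hd.pow 3).div_const 3)).div_const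
      (2 * r ^ 2 * s ^ 2)).congr_deriv ?_
    have hq := Real.sq_sqrt hp.le
    have hq0 := (Real.sqrt_pos.2 hp).ne'
    generalize Real.sqrt (r ^ 2 + s ^ 2 - 2 * r * (s * Real.cos t)) = D at *
    norm_num
    field_simp
    rw [hq]
    ring
  · exact (Real.continuous_cos.mul (ang_cont r s hrs hr hs)).intervalIntegrable _ _

lemma norm_sub_polar (u x : EuclideanSpace ℝ (Fin 3)) (hu : ‖u‖ = 1) (r : ℝ) :
    ‖r • u - x‖ = Real.sqrt (r ^ 2 + ‖x‖ ^ 2 - 2 * r * inner ℝ u x) := by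
  rw [← Real.sqrt_sq (norm_nonneg (r • u - x)), norm_sub_sq_real, norm_smul, hu, real_inner_smul_left]
  congr 1
  rw [mul_one, Real.norm_eq_abs, sq_abs]
  ring

lemma ae_ne_Ioi (r : ℝ) : ∀ᵐ s : ℝ ∂(volume.restrict (Set.Ioi (0:ℝ))), s ≠ r ∧ 0 < s := by
  filter_upwards [ae_restrict_mem measurableSet_Ioi,
    ae_restrict_of_ae (Measure.ae_ne volume r)] with s h1 h2
  exact ⟨h2, h1⟩

lemma ker_integrable (u : EuclideanSpace ℝ (Fin 3)) (hu : ‖u‖ = 1) (r R₀ : ℝ) (hr : 0 < r) :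
    IntegrableOn (fun x => ‖r • u - x‖⁻¹) (Metric.ball (0 : EuclideanSpace ℝ (Fin 3)) R₀) := by
  rw [← integrable_indicator_iff Metric.isOpen_ball.measurableSet]
  let G : ℝ × ℝ → ℝ := fun p =>
    (Set.Iio R₀).indicator (fun _ => (1:ℝ)) p.1 * (Real.sqrt (r ^ 2 + p.1 ^ 2 - 2 * r * p.2))⁻¹
  have hi : Measurable ((Set.Iio R₀).indicator (fun _ : ℝ => (1:ℝ))) :=
    measurable_const.indicator measurableSet_Iio
  have hG : Measurable G := by
    apply Measurable.mul (hi.comp measurable_fst)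
    fun_prop
  have h := (integrable_polar u hu G hG).2 ?_
  · refine h.congr (Filter.Eventually.of_forall fun x => ?_)
    by_cases h : ‖x‖ < R₀ <;>
      simp [G, norm_sub_polar u _ hu, Set.indicator_apply, h]
  · rw [Measure.volume_eq_prod, ← Measure.prod_restrict, integrable_prod_iff (by
      apply Measurable.aestronglyMeasurable
      apply Measurable.mul (by fun_prop)
      exact hG.comp (by fun_prop))]
    constructor
    · filter_upwards [ae_ne_Ioi r] with s hs
      have hc := ang_cont r s hs.1 hr hs.2
      have : IntegrableOn (fun t => Real.sin t /
        Real.sqrt (r ^ 2 + s ^ 2 - 2 * r * (s * Real.cos t))) (Set.Ioo 0 Real.pi) :=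
        (hc.integrableOn_Icc (a := 0) (b := Real.pi)).mono_set Set.Ioo_subset_Icc_self
      refine (Integrable.const_mul this
        (2 * Real.pi * s ^ 2 * (Set.Iio R₀).indicator (fun _ => (1:ℝ)) s)).congr
        (Filter.Eventually.of_forall fun t => ?_)
      simp only [G]
      ring
    · have h1 : IntegrableOn (fun s => 2 * Real.pi * s * (r + s - |r - s|) / r) (Set.Ioo 0 R₀) :=
        (Continuous.integrableOn_Icc (by fun_prop) (a := 0) (b := R₀)).mono_set
          Set.Ioo_subset_Icc_self
      rw [← integrable_indicator_iff measurableSet_Ioo] at h1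
      refine (h1.restrict (s := Set.Ioi 0)).congr ?_
      filter_upwards [ae_ne_Ioi r] with s hs
      have h2 : ∀ t ∈ Set.Ioo 0 Real.pi,
          ‖2 * Real.pi * (s ^ 2 * Real.sin t) * G (s, s * Real.cos t)‖
          = (2 * Real.pi * s ^ 2 * (Set.Iio R₀).indicator (fun _ => (1:ℝ)) s) *
            (Real.sin t / Real.sqrt (r ^ 2 + s ^ 2 - 2 * r * (s * Real.cos t))) := by
        intro t ht
        have h3 : 0 ≤ Real.sin t := Real.sin_nonneg_of_nonneg_of_le_pi ht.1.le ht.2.le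
        have h4 : 0 ≤ (Set.Iio R₀).indicator (fun _ => (1:ℝ)) s :=
          Set.indicator_nonneg (fun _ _ => zero_le_one) _
        have h5 : 0 ≤ G (s, s * Real.cos t) := by
          simp only [G]
          positivity
        rw [Real.norm_of_nonneg (by positivity)]
        simp only [G]
        ring
      rw [setIntegral_congr_fun measurableSet_Ioo h2, integral_const_mul,
        ang_int0 r s hs.1 hr hs.2]
      have := hs.2
      by_cases h : s < R₀
      · simp [Set.indicator_apply, h, this]
        field_simp
      · simp [Set.indicator_apply, h]

lemma pot_integrable (u : EuclideanSpace ℝ (Fin 3)) (hu : ‖u‖ = 1) (r R₀ : ℝ) (hr : 0 < r)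
    (g : ℝ → ℝ) (hg : Continuous g) (v : EuclideanSpace ℝ (Fin 3)) :
    IntegrableOn (fun x => g ‖x‖ * (‖x‖⁻¹ * inner ℝ v x) / ‖r • u - x‖)
      (Metric.ball (0 : EuclideanSpace ℝ (Fin 3)) R₀) := by
  obtain ⟨M, hM⟩ := (isCompact_Icc (a := (0:ℝ)) (b := R₀)).exists_bound_of_continuousOn
    hg.continuousOn
  refine Integrable.mono' ((ker_integrable u hu r R₀ hr).const_mul (M * ‖v‖))
    (by apply Measurable.aestronglyMeasurable; fun_prop) ?_
  filter_upwards [ae_restrict_mem Metric.isOpen_ball.measurableSet] with x hx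
  have h1 := hM ‖x‖ ⟨norm_nonneg _, by simpa using (mem_ball_zero_iff.1 hx).le⟩
  have h2 : ‖‖x‖⁻¹ * inner ℝ v x‖ ≤ ‖v‖ := by
    rw [norm_mul, norm_inv, norm_norm]
    by_cases h0 : ‖x‖ = 0
    · simp [h0]
    · rw [inv_mul_le_iff₀ (by positivity), mul_comm]
      exact norm_inner_le_norm v x
  rw [norm_div, norm_mul, norm_norm, div_eq_mul_inv]
  gcongr
  exact (norm_nonneg _).trans h1

lemma pot_formula0 (u : EuclideanSpace ℝ (Fin 3)) (hu : ‖u‖ = 1) (r R₀ : ℝ) (hr : 0 < r)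
    (hrR : r < R₀) (g : ℝ → ℝ) (hg : Continuous g) :
    ∫ x in Metric.ball (0 : EuclideanSpace ℝ (Fin 3)) R₀,
      g ‖x‖ * (‖x‖⁻¹ * inner ℝ u x) / ‖r • u - x‖
    = 4 * Real.pi / 3 * ((∫ s in (0:ℝ)..r, g s * s ^ 3) / r ^ 2 + r * ∫ s in r..R₀, g s) := by
  rw [← integral_indicator Metric.isOpen_ball.measurableSet]
  have hint := pot_integrable u hu r R₀ hr g hg u
  rw [← integrable_indicator_iff Metric.isOpen_ball.measurableSet] at hint
  let G : ℝ × ℝ → ℝ := fun p =>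
    (Set.Iio R₀).indicator (fun _ => (1:ℝ)) p.1 * (g p.1 * (p.1⁻¹ * p.2) *
      (Real.sqrt (r ^ 2 + p.1 ^ 2 - 2 * r * p.2))⁻¹)
  have hi : Measurable ((Set.Iio R₀).indicator (fun _ : ℝ => (1:ℝ))) :=
    measurable_const.indicator measurableSet_Iio
  have hG : Measurable G := by
    apply Measurable.mul (hi.comp measurable_fst)
    fun_prop
  have heq : (Metric.ball (0 : EuclideanSpace ℝ (Fin 3)) R₀).indicator
      (fun x => g ‖x‖ * (‖x‖⁻¹ * inner ℝ u x) / ‖r • u - x‖) = fun x => G (‖x‖, inner ℝ u x) := by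
    ext x
    by_cases h : ‖x‖ < R₀ <;>
      simp [G, norm_sub_polar u _ hu, Set.indicator_apply, h, div_eq_mul_inv]
  rw [heq] at hint ⊢
  have hint2 := (integrable_polar u hu G hG).1 hint
  rw [integral_polar u hu G hG]
  rw [Measure.volume_eq_prod] at hint2 ⊢
  rw [setIntegral_prod _ hint2]
  have h1 : ∀ᵐ s : ℝ ∂(volume.restrict (Set.Ioi (0:ℝ))),
      (∫ t in Set.Ioo 0 Real.pi, 2 * Real.pi * (s ^ 2 * Real.sin t) * G (s, s * Real.cos t))
      = (Set.Ioc 0 R₀).indicator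
        (fun s => if s < r then 4 * Real.pi / 3 / r ^ 2 * (g s * s ^ 3)
          else 4 * Real.pi / 3 * r * g s) s := by
    filter_upwards [ae_ne_Ioi r, ae_ne_Ioi R₀] with s hs hs'
    have h2 : ∀ t, 2 * Real.pi * (s ^ 2 * Real.sin t) * G (s, s * Real.cos t)
          = (2 * Real.pi * s ^ 2 * (Set.Iio R₀).indicator (fun _ => (1:ℝ)) s * g s) *
            (Real.cos t * 
              (Real.sin t / Real.sqrt (r ^ 2 + s ^ 2 - 2 * r * (s * Real.cos t)))) := by
      intro t
      have : s ≠ 0 := hs.2.ne'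
      simp only [G]
      rw [← mul_assoc s⁻¹ s, inv_mul_cancel₀ this]
      ring
    simp only [h2]
    rw [integral_const_mul, ang_int1 r s hs.1 hr hs.2]
    have h0 := hs.2
    by_cases h : s < R₀
    · simp only [Set.indicator_apply, Set.mem_Iio, Set.mem_Ioc, h, h0, h.le, and_self, if_true]
      split_ifs
      · field_simp
        ring
      · field_simp
        ring
    · have h' : ¬ s ≤ R₀ := fun h'' => h (lt_of_le_of_ne h'' hs'.1)
      simp [Set.indicator_apply, h, h']
  rw [integral_congr_ae h1, setIntegral_indicator measurableSet_Ioc]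
  have hset : Set.Ioi (0:ℝ) ∩ Set.Ioc 0 R₀ = Set.Ioc 0 R₀ :=
    Set.inter_eq_right.2 Set.Ioc_subset_Ioi_self
  rw [hset, ← Set.Ioc_union_Ioc_eq_Ioc hr.le hrR.le]
  have hc1 : Continuous fun s => 4 * Real.pi / 3 / r ^ 2 * (g s * s ^ 3) := by fun_prop
  have hc2 : Continuous fun s => 4 * Real.pi / 3 * r * g s := by fun_prop
  have ea : ∀ᵐ s ∂(volume.restrict (Set.Ioc 0 r)), 
      4 * Real.pi / 3 / r ^ 2 * (g s * s ^ 3) = (if s < r then 4 * Real.pi / 3 / r ^ 2 * (g s * s ^ 3)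
          else 4 * Real.pi / 3 * r * g s) := by
    filter_upwards [ae_restrict_mem measurableSet_Ioc,
      ae_restrict_of_ae (Measure.ae_ne volume r)] with s h1 h2
    rw [if_pos (lt_of_le_of_ne h1.2 h2)]
  have eb : ∀ᵐ s ∂(volume.restrict (Set.Ioc r R₀)), 
      4 * Real.pi / 3 * r * g s = (if s < r then 4 * Real.pi / 3 / r ^ 2 * (g s * s ^ 3)
          else 4 * Real.pi / 3 * r * g s) := by
    filter_upwards [ae_restrict_mem measurableSet_Ioc] with s h1
    rw [if_neg (not_lt.2 h1.1.le)]
  rw [setIntegral_union (Set.Ioc_disjoint_Ioc_of_le le_rfl) measurableSet_Ioc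
    (Integrable.congr (hc1.integrableOn_Ioc) ea) (Integrable.congr (hc2.integrableOn_Ioc) eb),
    ← integral_congr_ae ea, ← integral_congr_ae eb,
    integral_const_mul, integral_const_mul, intervalIntegral.integral_of_le hr.le,
    intervalIntegral.integral_of_le hrR.le]
  ring

lemma pot_formula (X : EuclideanSpace ℝ (Fin 3)) (R₀ : ℝ) (hX : X ≠ 0)
    (hrR : ‖X‖ < R₀) (g : ℝ → ℝ) (hg : Continuous g) (j : Fin 3) :
    ∫ x in Metric.ball (0 : EuclideanSpace ℝ (Fin 3)) R₀,
      g ‖x‖ * (‖x‖⁻¹ * x j) / ‖X - x‖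
    = X j * (4 * Real.pi / 3 * ((∫ s in (0:ℝ)..‖X‖, g s * s ^ 3) / ‖X‖ ^ 3 +
        ∫ s in ‖X‖..R₀, g s)) := by
  have hr : 0 < ‖X‖ := norm_pos_iff.2 hX
  set r := ‖X‖ with hrdef
  obtain ⟨u, hu⟩ : ∃ u, u = r⁻¹ • X := ⟨_, rfl⟩
  have hu1 : ‖u‖ = 1 := by
    rw [hu, norm_smul, norm_inv, norm_norm]
    exact inv_mul_cancel₀ hr.ne'
  have hXu : X = r • u := by rw [hu, smul_smul, mul_inv_cancel₀ hr.ne', one_smul]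
  have hXj : X j = r * u j := by rw [hXu]; simp
  set e : EuclideanSpace ℝ (Fin 3) := EuclideanSpace.single j 1 with he
  have hej : ∀ x : EuclideanSpace ℝ (Fin 3), x j = inner ℝ e x := by
    intro x; simp [he, EuclideanSpace.inner_single_left]
  have I1 := pot_integrable u hu1 r R₀ hr g hg u
  have I2 := pot_integrable u hu1 r R₀ hr g hg e
  have F := pot_formula0 u hu1 r R₀ hr hrR g hg
  rw [hXu] at hXj ⊢
  rw [hXj]
  simp only [hej]
  let S : EuclideanSpace ℝ (Fin 3) ≃ₗᵢ[ℝ] EuclideanSpace ℝ (Fin 3) :=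
    (Submodule.span ℝ {u}).reflection
  have hS : ∀ x, S x = (2 * inner ℝ u x) • u - x := by
    intro x
    simp only [S, Submodule.reflection_singleton_apply, hu1]
    simp [two_smul, two_mul, add_smul]
  have hSu : S u = u := by
    rw [hS, real_inner_self_eq_norm_sq, hu1]
    simp [two_smul]
  have key : ∫ x in Metric.ball (0 : EuclideanSpace ℝ (Fin 3)) R₀,
      g ‖x‖ * (‖x‖⁻¹ * inner ℝ e x) / ‖r • u - x‖ = 
      ∫ x in Metric.ball (0 : EuclideanSpace ℝ (Fin 3)) R₀,
      ((2 * inner ℝ e u) * (g ‖x‖ * (‖x‖⁻¹ * inner ℝ u x) / ‖r • u - x‖)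
        - g ‖x‖ * (‖x‖⁻¹ * inner ℝ e x) / ‖r • u - x‖) := by
    rw [← S.measurePreserving.setIntegral_preimage_emb S.toHomeomorph.measurableEmbedding]
    have hpre : S ⁻¹' Metric.ball (0 : EuclideanSpace ℝ (Fin 3)) R₀ = Metric.ball 0 R₀ := by
      ext x; simp
    rw [hpre]
    congr 1; ext x
    have h1 : ‖r • u - S x‖ = ‖r • u - x‖ := by
      rw [← S.norm_map (r • u - x), map_sub, map_smul, hSu]
    rw [h1, S.norm_map, hS, inner_sub_right, real_inner_smul_right]
    ring
  rw [integral_sub (I1.const_mul _) I2, integral_const_mul, F] at key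
  have : ∫ x in Metric.ball (0 : EuclideanSpace ℝ (Fin 3)) R₀,
      g ‖x‖ * (‖x‖⁻¹ * inner ℝ e x) / ‖r • u - x‖ = inner ℝ e u *
      (4 * Real.pi / 3 * ((∫ s in (0:ℝ)..r, g s * s ^ 3) / r ^ 2 + r * ∫ s in r..R₀, g s)) := by
    linarith
  rw [this]
  field_simp

lemma hasFDerivAt_comp_norm (H : ℝ → ℝ) (H' : ℝ) (Y : EuclideanSpace ℝ (Fin 3)) (hY : Y ≠ 0)
    (h : HasDerivAt H H' ‖Y‖) :
    HasFDerivAt (fun Z : EuclideanSpace ℝ (Fin 3) => H ‖Z‖) ((H' / ‖Y‖) • innerSL ℝ Y) Y := by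
  have hn : HasFDerivAt (fun Z : EuclideanSpace ℝ (Fin 3) => ‖Z‖) (‖Y‖⁻¹ • innerSL ℝ Y) Y := by
    have h1 := (hasStrictFDerivAt_norm_sq Y).hasFDerivAt.sqrt
      (by have := norm_pos_iff.2 hY; positivity)
    simp only [Real.sqrt_sq (norm_nonneg _)] at h1
    refine h1.congr_fderiv ?_
    ext v
    simp
    field_simp
  refine (h.comp_hasFDerivAt Y hn).congr_fderiv ?_
  rw [smul_smul, div_eq_mul_inv]

lemma hasFDerivAt_coord (j : Fin 3) (Y : EuclideanSpace ℝ (Fin 3)) :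
    HasFDerivAt (fun Z : EuclideanSpace ℝ (Fin 3) => Z j)
      (EuclideanSpace.proj j : EuclideanSpace ℝ (Fin 3) →L[ℝ] ℝ) Y :=
  (EuclideanSpace.proj j : EuclideanSpace ℝ (Fin 3) →L[ℝ] ℝ).hasFDerivAt

lemma h_deriv (g : ℝ → ℝ) (hg : Continuous g) (R₀ r : ℝ) (hr : 0 < r) :
    HasDerivAt (fun r => 4 * Real.pi / 3 * ((∫ s in (0:ℝ)..r, g s * s ^ 3) / r ^ 3 +
        ∫ s in r..R₀, g s)) (-(4 * Real.pi) * (∫ s in (0:ℝ)..r, g s * s ^ 3) / r ^ 4) r := by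
  have hA : HasDerivAt (fun r => ∫ s in (0:ℝ)..r, g s * s ^ 3) (g r * r ^ 3) r :=
    intervalIntegral.integral_hasDerivAt_right
        (Continuous.intervalIntegrable (by fun_prop) _ _)
        (Continuous.stronglyMeasurableAtFilter (by fun_prop) _ _)
        (Continuous.continuousAt (by fun_prop))
  have hB : HasDerivAt (fun r => ∫ s in r..R₀, g s) (-g r) r :=
    intervalIntegral.integral_hasDerivAt_left (hg.intervalIntegrable _ _)
      (hg.stronglyMeasurableAtFilter _ _) hg.continuousAt
  refine (((hA.div (hasDerivAt_pow 3 r) (by positivity)).add hB).const_mul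
    (4 * Real.pi / 3)).congr_deriv ?_
  norm_num
  field_simp
  ring

lemma k_deriv (g : ℝ → ℝ) (hg : Continuous g) (r : ℝ) (hr : 0 < r) :
    HasDerivAt (fun r => -(4 * Real.pi) * (∫ s in (0:ℝ)..r, g s * s ^ 3) / r ^ 5)
      (-(4 * Real.pi) * (g r / r ^ 2 - 5 * (∫ s in (0:ℝ)..r, g s * s ^ 3) / r ^ 6)) r := by
  have hA : HasDerivAt (fun r => ∫ s in (0:ℝ)..r, g s * s ^ 3) (g r * r ^ 3) r :=
    intervalIntegral.integral_hasDerivAt_right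
        (Continuous.intervalIntegrable (by fun_prop) _ _)
        (Continuous.stronglyMeasurableAtFilter (by fun_prop) _ _)
        (Continuous.continuousAt (by fun_prop))
  refine ((hA.const_mul (-(4 * Real.pi))).div (hasDerivAt_pow 5 r) (by positivity)).congr_deriv ?_
  norm_num
  field_simp
  ring

theorem stmt14 (R₀ : ℝ) (hR₀ : 0 < R₀) (ρ : ℝ → ℝ)
    (hρcont : ContinuousOn ρ (Set.Icc 0 R₀))
    (hρpos : ∀ R ∈ Set.Icc (0:ℝ) R₀, 0 < ρ R)
    (F : ℝ → ℝ) (hF : ContDiffOn ℝ 1 F (Set.Icc 0 R₀)) (hF0 : F 0 = 0)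
    (ξ : EuclideanSpace ℝ (Fin 3) → EuclideanSpace ℝ (Fin 3))
    (hξ : ∀ X : EuclideanSpace ℝ (Fin 3), X ≠ 0 → ξ X = F ‖X‖ • (‖X‖⁻¹ • X))
    (V : Fin 3 → EuclideanSpace ℝ (Fin 3) → ℝ)
    (hV : ∀ j X, V j X = ∫ X' in Metric.ball (0 : EuclideanSpace ℝ (Fin 3)) R₀,
      ρ ‖X'‖ * ξ X' j / ‖X - X'‖) :
    ∀ X : EuclideanSpace ℝ (Fin 3), X ∈ Metric.ball 0 R₀ → X ≠ 0 →
      ∀ i : Fin 3,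
        (∑ j : Fin 3,
            fderiv ℝ (fun Y => fderiv ℝ (V j) Y (EuclideanSpace.single j 1)) X
              (EuclideanSpace.single i 1))
          = -(4 * Real.pi) * ρ ‖X‖ * ξ X i := by
  intro X hXb hX0 i
  obtain ⟨g, hg, hgeq⟩ : ∃ g : ℝ → ℝ, Continuous g ∧ ∀ s ∈ Set.Icc 0 R₀, g s = ρ s * F s := by
    have hc : ContinuousOn (fun s => ρ s * F s) (Set.Icc 0 R₀) := hρcont.mul hF.continuousOn
    refine ⟨Set.IccExtend hR₀.le ((Set.Icc 0 R₀).domRestrict fun s => ρ s * F s),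
      (continuousOn_iff_continuous_domRestrict.1 hc).Icc_extend', ?_⟩
    intro s hs
    rw [Set.IccExtend_of_mem _ _ hs]
    rfl
  have hVf : ∀ j Y, Y ∈ Metric.ball (0 : EuclideanSpace ℝ (Fin 3)) R₀ → Y ≠ 0 → V j Y =
      Y j * (4 * Real.pi / 3 * ((∫ s in (0:ℝ)..‖Y‖, g s * s ^ 3) / ‖Y‖ ^ 3 +
        ∫ s in ‖Y‖..R₀, g s)) := by
    intro j Y hY hY0
    rw [hV, ← pot_formula Y R₀ hY0 (by simpa using hY) g hg j]
    apply integral_congr_ae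
    filter_upwards [ae_restrict_mem Metric.isOpen_ball.measurableSet,
      ae_restrict_of_ae (Measure.ae_ne volume 0)] with x hx hx0
    rw [hgeq _ ⟨norm_nonneg _, (mem_ball_zero_iff.1 hx).le⟩, hξ x hx0]
    simp only [PiLp.smul_apply, smul_eq_mul]
    ring
  have hnhds : ∀ Y, Y ∈ Metric.ball (0 : EuclideanSpace ℝ (Fin 3)) R₀ → Y ≠ 0 →
      ∀ᶠ Z in nhds Y, Z ∈ Metric.ball (0 : EuclideanSpace ℝ (Fin 3)) R₀ ∧ Z ≠ 0 := by
    intro Y hY hY0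
    exact Filter.Eventually.and (Metric.isOpen_ball.mem_nhds hY) (isOpen_ne.mem_nhds hY0)
  have h1 : ∀ j Y, Y ∈ Metric.ball (0 : EuclideanSpace ℝ (Fin 3)) R₀ → Y ≠ 0 →
      fderiv ℝ (V j) Y (EuclideanSpace.single j 1) =
      (4 * Real.pi / 3 * ((∫ s in (0:ℝ)..‖Y‖, g s * s ^ 3) / ‖Y‖ ^ 3 +
        ∫ s in ‖Y‖..R₀, g s)) +
      Y j ^ 2 * (-(4 * Real.pi) * (∫ s in (0:ℝ)..‖Y‖, g s * s ^ 3) / ‖Y‖ ^ 5) := by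
    intro j Y hY hY0
    have hr := norm_pos_iff.2 hY0
    have hd := (hasFDerivAt_coord j Y).mul
      (hasFDerivAt_comp_norm _ _ Y hY0 (h_deriv g hg R₀ ‖Y‖ hr))
    have he := hd.congr_of_eventuallyEq (f₁ := V j)
      ((hnhds Y hY hY0).mono fun Z hZ => hVf j Z hZ.1 hZ.2)
    rw [he.fderiv]
    simp [EuclideanSpace.inner_single_right]
    field_simp
    ring
  have hr := norm_pos_iff.2 hX0
  have h2 : ∀ j, fderiv ℝ (fun Y => fderiv ℝ (V j) Y (EuclideanSpace.single j 1)) X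
              (EuclideanSpace.single i 1) = 
      (-(4 * Real.pi) * (∫ s in (0:ℝ)..‖X‖, g s * s ^ 3) / ‖X‖ ^ 4) / ‖X‖ * X i
      + (X j ^ 2 * ((-(4 * Real.pi) * (g ‖X‖ / ‖X‖ ^ 2 - 
          5 * (∫ s in (0:ℝ)..‖X‖, g s * s ^ 3) / ‖X‖ ^ 6)) / ‖X‖ * X i)
        + (-(4 * Real.pi) * (∫ s in (0:ℝ)..‖X‖, g s * s ^ 3) / ‖X‖ ^ 5) * 
          (2 * X j * (if j = i then 1 else 0))) := by
    intro j
    have hd := (hasFDerivAt_comp_norm _ _ X hX0 (h_deriv g hg R₀ ‖X‖ hr)).add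
      (((hasFDerivAt_coord j X).pow 2).mul
        (hasFDerivAt_comp_norm _ _ X hX0 (k_deriv g hg ‖X‖ hr)))
    have he := hd.congr_of_eventuallyEq
      (f₁ := (fun Y => fderiv ℝ (V j) Y (EuclideanSpace.single j 1)))
      ((hnhds X hXb hX0).mono fun Z hZ => h1 j Z hZ.1 hZ.2)
    rw [he.fderiv]
    by_cases hij : j = i <;>
    simp [EuclideanSpace.inner_single_right, hij]
  simp only [h2]
  have hsq : ‖X‖ ^ 2 = X 0 ^ 2 + X 1 ^ 2 + X 2 ^ 2 := by
    rw [EuclideanSpace.norm_sq_eq]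
    simp [Fin.sum_univ_three]
  have hsum : ∑ j : Fin 3, (2 * X j * (if j = i then (1:ℝ) else 0)) = 2 * X i := by
    simp
  rw [Finset.sum_add_distrib, Finset.sum_add_distrib, ← Finset.mul_sum Finset.univ (fun j => 2 * X j * (if j = i then (1:ℝ) else 0)),
    hsum, ← Finset.sum_mul Finset.univ (fun j => X j ^ 2),
    Fin.sum_univ_three (fun j => X j ^ 2), ← hsq, hξ X hX0,
    hgeq _ ⟨norm_nonneg _, (mem_ball_zero_iff.1 hXb).le⟩]
  simp
  field_simp
  ring
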